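/- Let 1 ≤ m ≤ N and let Σ be a multiset of N complex numbers. Then: (a) for every integer p ≥ N + 1, the identity h_p(X−Σ) = Σ_{j=1}^{m} (−1)^{j−1} e_j · h_{p−j}(X−Σ) holds in ℂ[x₁,…,x_m]; and consequently (b) for every integer p ≥ N + 1 − m, the polynomial h_p(X−Σ) lies in the ideal of Sym generated by h_{N+1−m}(X−Σ), h_{N+2−m}(X−Σ), …, h_N(X−Σ). -/

import Mathlib

set_option synthInstance.maxHeartbeats 1000000
set_option maxHeartbeats 1000000

open MvPolynomial

/-- `h_k(X−Σ) := ∑_{j=0}^{k} (−1)^j e_j(Σ)·h_{k−j}` in `ℂ[x₁,…,x_m]`. -/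
noncomputable def hXSPoly (m : ℕ) (S : Multiset ℂ) (k : ℕ) : MvPolynomial (Fin m) ℂ :=
  ∑ j ∈ Finset.range (k + 1), ((-1 : ℂ) ^ j * S.esymm j) • hsymm (Fin m) ℂ (k - j)

/-- The `k`-th complete homogeneous symmetric polynomial in `m` variables, as an element of the
subalgebra of symmetric polynomials. -/
noncomputable def hSymElt (m k : ℕ) : symmetricSubalgebra (Fin m) ℂ :=
  ⟨hsymm (Fin m) ℂ k, (mem_symmetricSubalgebra _).2 (hsymm_isSymmetric (Fin m) ℂ k)⟩

/-- `h_k(X−Σ)` as an element of the algebra of symmetric polynomials in `m` variables. -/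
noncomputable def hXSElt (m : ℕ) (S : Multiset ℂ) (k : ℕ) : symmetricSubalgebra (Fin m) ℂ :=
  ∑ j ∈ Finset.range (k + 1), ((-1 : ℂ) ^ j * S.esymm j) • hSymElt m (k - j)

theorem Multiset.esymm_eq_zero_of_card_lt {R : Type*} [CommSemiring R] {s : Multiset R} {k : ℕ}
    (h : s.card < k) : s.esymm k = 0 := by
  simp [Multiset.esymm, Multiset.powersetCard_eq_empty k h]

theorem Multiset.esymm_cons_succ {R : Type*} [CommSemiring R] (a : R) (s : Multiset R) (k : ℕ) :
    (a ::ₘ s).esymm (k + 1) = s.esymm (k + 1) + a * s.esymm k := by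
  simp [Multiset.esymm, Multiset.powersetCard_cons, Multiset.sum_map_mul_left]

theorem PowerSeries.coeff_prod_one_sub_C_mul_X {R : Type*} [CommRing R] (s : Multiset R) (k : ℕ) :
    coeff k (s.map fun a => 1 - C a * X).prod = (-1) ^ k * s.esymm k := by
  induction s using Multiset.induction generalizing k with
  | empty =>
    cases k with
    | zero => simp [Multiset.esymm]
    | succ k =>
      rw [Multiset.esymm_eq_zero_of_card_lt (by simp)]
      simp [coeff_one]
  | cons a s ih =>
    rw [Multiset.map_cons, Multiset.prod_cons, sub_mul, one_mul, map_sub, mul_assoc,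
      coeff_C_mul]
    cases k with
    | zero => simp [ih, Multiset.esymm]
    | succ k =>
      rw [coeff_succ_X_mul, ih, ih, Multiset.esymm_cons_succ]
      ring

theorem MvPolynomial.mk_hsymm_eq_prod (σ R : Type*) [Fintype σ] [DecidableEq σ] [CommRing R] :
    PowerSeries.mk (hsymm σ R) = ∏ i, PowerSeries.mk fun k => (X i : MvPolynomial σ R) ^ k := by
  ext1 n
  simp only [PowerSeries.coeff_prod, PowerSeries.coeff_mk, hsymm]
  refine Finset.sum_bij (fun s _ => Multiset.toFinsupp s.1) (fun s _ => ?_)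
    (fun s _ t _ h => Subtype.ext (Multiset.toFinsupp.injective h)) (fun l hl => ?_)
    (fun s _ => ?_)
  · rw [Finset.mem_finsuppAntidiag']
    exact ⟨(Multiset.toFinsupp_sum_eq _).trans s.2, Finset.subset_univ _⟩
  · rw [Finset.mem_finsuppAntidiag'] at hl
    exact ⟨⟨Finsupp.toMultiset l, (Finsupp.card_toMultiset l).trans hl.1⟩,
      Finset.mem_univ _, by simp⟩
  · simp only [Multiset.toFinsupp_apply]
    rw [Finset.prod_multiset_map_count]
    refine Finset.prod_subset (Finset.subset_univ _) fun i _ hi => ?_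
    rw [Multiset.count_eq_zero_of_notMem (by simpa using hi), pow_zero]

theorem PowerSeries.mk_pow_mul_one_sub_C_mul_X {R : Type*} [CommRing R] (a : R) :
    mk (fun k => a ^ k) * (1 - C a * X) = 1 := by
  ext k
  rw [mul_sub, mul_one, mul_left_comm, map_sub, coeff_C_mul]
  cases k with
  | zero => simp
  | succ k => simp [coeff_succ_mul_X, coeff_one, pow_succ']

theorem MvPolynomial.prod_one_sub_mul_mk_hsymm (σ R : Type*) [Fintype σ] [DecidableEq σ]
    [CommRing R] :
    ((Finset.univ.val.map (X : σ → MvPolynomial σ R)).map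
      fun a => 1 - PowerSeries.C a * PowerSeries.X).prod * PowerSeries.mk (hsymm σ R) = 1 := by
  rw [mk_hsymm_eq_prod, Multiset.map_map, mul_comm]
  change (∏ i, _) * (∏ i, _) = _
  rw [← Finset.prod_mul_distrib]
  exact Finset.prod_eq_one fun i _ => PowerSeries.mk_pow_mul_one_sub_C_mul_X _

theorem mk_hXSPoly (m : ℕ) (S : Multiset ℂ) :
    PowerSeries.mk (hXSPoly m S) =
      PowerSeries.map C (S.map fun a => 1 - PowerSeries.C a * PowerSeries.X).prod *
        PowerSeries.mk (hsymm (Fin m) ℂ) := by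
  ext1 k
  rw [PowerSeries.coeff_mul, Finset.Nat.sum_antidiagonal_eq_sum_range_succ_mk]
  simp only [PowerSeries.coeff_mk, PowerSeries.coeff_map, PowerSeries.coeff_prod_one_sub_C_mul_X,
    hXSPoly, smul_eq_C_mul]

theorem sum_esymm_mul_hXSPoly_eq_zero {m p : ℕ} {S : Multiset ℂ} (hp : S.card < p) :
    ∑ j ∈ Finset.range (p + 1), (-1) ^ j * esymm (Fin m) ℂ j * hXSPoly m S (p - j) = 0 := by
  have h : PowerSeries.coeff p
      (((Finset.univ.val.map (X : Fin m → MvPolynomial (Fin m) ℂ)).map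
        fun a => 1 - PowerSeries.C a * PowerSeries.X).prod * PowerSeries.mk (hXSPoly m S)) = 0 := by
    rw [mk_hXSPoly, mul_left_comm, prod_one_sub_mul_mk_hsymm, mul_one, PowerSeries.coeff_map,
      PowerSeries.coeff_prod_one_sub_C_mul_X, Multiset.esymm_eq_zero_of_card_lt hp, mul_zero,
      map_zero]
  rw [PowerSeries.coeff_mul, Finset.Nat.sum_antidiagonal_eq_sum_range_succ_mk] at h
  simpa only [PowerSeries.coeff_mk, PowerSeries.coeff_prod_one_sub_C_mul_X,
    ← esymm_eq_multiset_esymm] using h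

theorem hXSPoly_eq_sum_esymm_mul {m p : ℕ} {S : Multiset ℂ} (hm : m ≤ p) (hp : S.card < p) :
    hXSPoly m S p =
      ∑ j ∈ Finset.Icc 1 m, ((-1 : ℂ) ^ (j - 1)) • (esymm (Fin m) ℂ j * hXSPoly m S (p - j)) := by
  have h := sum_esymm_mul_hXSPoly_eq_zero (m := m) hp
  rw [← Finset.sum_subset (Finset.range_mono (Nat.succ_le_succ hm)) fun j _ hj => ?_,
    Finset.sum_range_succ'] at h
  · rw [← Finset.Ico_succ_right_eq_Icc, Finset.sum_Ico_eq_sum_range, ← sub_eq_zero, ← h,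
      sub_eq_neg_add, ← Finset.sum_neg_distrib]
    simp [smul_eq_C_mul, pow_succ, add_comm 1, mul_assoc]
  · have hj : (Finset.univ.val.map (X : Fin m → MvPolynomial (Fin m) ℂ)).card < j := by
      simpa using hj
    rw [esymm_eq_multiset_esymm, Multiset.esymm_eq_zero_of_card_lt hj, mul_zero, zero_mul]

theorem coe_hXSElt (m : ℕ) (S : Multiset ℂ) (k : ℕ) :
    (hXSElt m S k : MvPolynomial (Fin m) ℂ) = hXSPoly m S k := by
  simp [hXSElt, hXSPoly, hSymElt]

/-- (a) For `p ≥ N + 1`, `h_p(X−Σ) = ∑_{j=1}^{m} (−1)^{j−1} e_j·h_{p−j}(X−Σ)` in `ℂ[x₁,…,x_m]`;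
(b) consequently, for every `p ≥ N + 1 − m`, `h_p(X−Σ)` lies in the ideal of the ring of
symmetric polynomials generated by `h_{N+1−m}(X−Σ), …, h_N(X−Σ)`. -/
theorem hXS_recursion_and_ideal_membership (N m : ℕ) (hm : 1 ≤ m) (hmN : m ≤ N)
    (S : Multiset ℂ) (hS : Multiset.card S = N) :
    (∀ p : ℕ, N + 1 ≤ p →
      hXSPoly m S p
        = ∑ j ∈ Finset.Icc 1 m, ((-1 : ℂ) ^ (j - 1)) • (esymm (Fin m) ℂ j * hXSPoly m S (p - j))) ∧
    (∀ p : ℕ, N + 1 - m ≤ p →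
      hXSElt m S p ∈ Ideal.span ((fun k => hXSElt m S k) '' Set.Icc (N + 1 - m) N)) := by
  refine ⟨fun p hp => hXSPoly_eq_sum_esymm_mul (by omega) (by omega), fun p => ?_⟩
  induction p using Nat.strong_induction_on with
  | _ p ih =>
    intro hp
    by_cases hpN : p ≤ N
    · exact Ideal.subset_span ⟨p, ⟨hp, hpN⟩, rfl⟩
    have h : hXSElt m S p = ∑ j ∈ Finset.Icc 1 m,
        ((-1 : ℂ) ^ (j - 1)) • ((⟨esymm (Fin m) ℂ j, (mem_symmetricSubalgebra _).2
          (esymm_isSymmetric (Fin m) ℂ j)⟩ : symmetricSubalgebra (Fin m) ℂ) *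
            hXSElt m S (p - j)) := by
      apply Subtype.ext
      rw [coe_hXSElt, hXSPoly_eq_sum_esymm_mul (by omega) (by omega)]
      simp [coe_hXSElt]
    rw [h]
    refine Ideal.sum_mem _ fun j hj => Submodule.smul_of_tower_mem _ _ (Ideal.mul_mem_left _ _ ?_)
    rw [Finset.mem_Icc] at hj
    exact ih _ (by omega) (by omega)
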